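/- Every polybounded semigroup is polyfinite. -/

import Mathlib

open Cardinal Pointwise

universe u

namespace ZeroClosedPaper

/-- The value of the semigroup polynomial with coefficient list `a = [a₀, a₁, …, aₙ]`
(coefficients in `X¹ = WithOne X`) at the point `x`, i.e. `a₀xa₁x⋯xaₙ`,
computed in the monoid `WithOne X`. Its degree (the number of occurrences of `x`)
is `a.length - 1`. -/
def polyVal {X : Type*} [Semigroup X] (a : List (WithOne X)) (x : X) : WithOne X :=
  match a with
  | [] => 1
  | a₀ :: rest => a₀ * (rest.map (fun ai => (x : WithOne X) * ai)).prod

/-- A subset `A` of a semigroup `X` is algebraic if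
`A = {x ∈ X : a₀xa₁⋯xaₙ = b}` for some `n ≥ 1`, `b ∈ X` and `a₀,…,aₙ ∈ X¹`. -/
def IsAlgebraicSet {X : Type*} [Semigroup X] (A : Set X) : Prop :=
  ∃ (a : List (WithOne X)) (b : X), 2 ≤ a.length ∧
    A = {x : X | polyVal a x = (b : WithOne X)}

/-- The polyboundedness number `cov(A_X)`: the smallest cardinality of a cover of `X`
by algebraic subsets of `X`. -/
noncomputable def covA (X : Type*) [Semigroup X] : Cardinal :=
  sInf {c : Cardinal | ∃ C : Set (Set X), (∀ A ∈ C, IsAlgebraicSet A) ∧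
    ⋃₀ C = Set.univ ∧ Cardinal.mk ↥C = c}

/-- A subset `S` of a semigroup `X` is polybounded in `X` if it can be covered by
finitely many algebraic subsets of `X`. -/
def PolyboundedIn {X : Type*} [Semigroup X] (S : Set X) : Prop :=
  ∃ C : Set (Set X), C.Finite ∧ (∀ A ∈ C, IsAlgebraicSet A) ∧ S ⊆ ⋃₀ C

/-- A semigroup is polybounded if it admits a finite cover by algebraic sets. -/
def Polybounded (X : Type*) [Semigroup X] : Prop :=
  PolyboundedIn (Set.univ : Set X)

/-- A semigroup `X` is polyfinite if there are `n ∈ ℕ` and a finite `F ⊆ X` such that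
for all `x, y ∈ X` some semigroup polynomial `f` of degree `≤ n` has `f(x), f(y) ∈ F`. -/
def Polyfinite (X : Type*) [Semigroup X] : Prop :=
  ∃ (n : ℕ) (F : Set X), F.Finite ∧ ∀ x y : X, ∃ a : List (WithOne X),
    2 ≤ a.length ∧ a.length ≤ n + 1 ∧
    (∃ u ∈ F, polyVal a x = (u : WithOne X)) ∧
    (∃ v ∈ F, polyVal a y = (v : WithOne X))

/-- A semigroup `X` is zero-closed if `X` is closed in its `0`-extension
`X⁰ = WithZero X` endowed with any Hausdorff semigroup topology. -/
def ZeroClosed (X : Type*) [Semigroup X] : Prop :=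
  ∀ τ : TopologicalSpace (WithZero X),
    @T2Space (WithZero X) τ → @ContinuousMul (WithZero X) τ _ →
    @IsClosed (WithZero X) τ (Set.range ((↑) : X → WithZero X))

/-- `d` is a pseudometric. -/
def IsPseudometric {X : Type*} (d : X → X → ℝ) : Prop :=
  (∀ x, d x x = 0) ∧ (∀ x y, d x y = d y x) ∧ (∀ x y z, d x z ≤ d x y + d y z)

/-- `d` is subinvariant: `d(axb, ayb) ≤ d(x,y)` for all `a, b ∈ X¹`
(equivalently, `d` is both left- and right-nonexpansive under translations). -/
def Subinvariant {X : Type*} [Semigroup X] (d : X → X → ℝ) : Prop :=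
  (∀ a x y : X, d (a * x) (a * y) ≤ d x y) ∧
  (∀ b x y : X, d (x * b) (y * b) ≤ d x y)

/-- `d` is separable: some countable set is `d`-dense. -/
def SeparablePseudometric {X : Type*} (d : X → X → ℝ) : Prop :=
  ∃ C : Set X, C.Countable ∧ ∀ x : X, ∀ ε : ℝ, 0 < ε → ∃ c ∈ C, d x c < ε

/-- `cov(M)`: the smallest cardinality of a cover of the real line by meager sets. -/
noncomputable def covMeager : Cardinal :=
  sInf {c : Cardinal | ∃ S : Set (Set ℝ), (∀ A ∈ S, IsMeagre A) ∧
    ⋃₀ S = Set.univ ∧ Cardinal.mk ↥S = c}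

/-- `cov(N̄)`: the smallest cardinality of a cover of the real line by closed
Lebesgue-null sets. -/
noncomputable def covClosedNull : Cardinal :=
  sInf {c : Cardinal | ∃ S : Set (Set ℝ),
    (∀ A ∈ S, IsClosed A ∧ MeasureTheory.volume A = 0) ∧
    ⋃₀ S = Set.univ ∧ Cardinal.mk ↥S = c}

/-- A topological space is power-Lindelöf if each finite power is Lindelöf. -/
def PowerLindelof (Y : Type*) [TopologicalSpace Y] : Prop :=
  ∀ n : ℕ, LindelofSpace (Fin n → Y)

/-- `I` is an ideal of the semigroup `X`. -/
def IsIdeal {X : Type*} [Semigroup X] (I : Set X) : Prop :=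
  ∀ x ∈ I, ∀ a : X, x * a ∈ I ∧ a * x ∈ I

theorem polyVal_cons_cons {X : Type*} [Semigroup X] (a b : WithOne X) (l : List (WithOne X))
    (x : X) : polyVal (a :: b :: l) x = a * (x * polyVal (b :: l) x) := by
  simp [polyVal, mul_assoc]

theorem polyVal_mul_cons {X : Type*} [Semigroup X] (c a : WithOne X) (l : List (WithOne X))
    (x : X) : polyVal (c * a :: l) x = c * polyVal (a :: l) x := by
  simp [polyVal, mul_assoc]

/-- The product of two semigroup polynomials is a semigroup polynomial. -/
theorem exists_polyVal_eq_mul {X : Type*} [Semigroup X] (l m : List (WithOne X))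
    (hl : l ≠ []) (hm : m ≠ []) : ∃ n : List (WithOne X),
      n.length + 1 = l.length + m.length ∧ ∀ x, polyVal n x = polyVal l x * polyVal m x := by
  obtain ⟨c, m, rfl⟩ := List.exists_cons_of_ne_nil hm
  obtain ⟨a, l, rfl⟩ := List.exists_cons_of_ne_nil hl
  induction l generalizing a with
  | nil => exact ⟨a * c :: m, by simp; omega, fun x => by simp [polyVal, mul_assoc]⟩
  | cons b l ih =>
    obtain ⟨n, hn, h⟩ := ih b (by simp)
    obtain ⟨d, n, rfl⟩ := List.exists_cons_of_ne_nil (l := n) (by rintro rfl; simp at hn; omega)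
    refine ⟨a :: d :: n, by simp at hn ⊢; omega, fun x => ?_⟩
    rw [polyVal_cons_cons, polyVal_cons_cons, h, mul_assoc, mul_assoc]

/-- The composition of two semigroup polynomials is a semigroup polynomial. -/
theorem exists_polyVal_eq_comp {X : Type*} [Semigroup X] (l m : List (WithOne X))
    (hl : l ≠ []) (hm : 2 ≤ m.length) (f : X → X) (hf : ∀ x, polyVal m x = f x) :
    ∃ n : List (WithOne X), l.length ≤ n.length ∧ ∀ x, polyVal n x = polyVal l (f x) := by
  obtain ⟨a, l, rfl⟩ := List.exists_cons_of_ne_nil hl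
  induction l generalizing a with
  | nil => exact ⟨[a], le_rfl, fun x => by simp [polyVal]⟩
  | cons b l ih =>
    obtain ⟨n, hn, h⟩ := ih b (by simp)
    obtain ⟨k, hk, h'⟩ := exists_polyVal_eq_mul m n (by rintro rfl; simp at hm)
      (by rintro rfl; simp at hn)
    obtain ⟨d, k, rfl⟩ := List.exists_cons_of_ne_nil (l := k) (by
      rintro rfl; simp at hk hn; omega)
    refine ⟨a * d :: k, by simp at hk hn ⊢; omega, fun x => ?_⟩
    rw [polyVal_mul_cons, polyVal_cons_cons, h', h, hf]

/-- A semigroup polynomial of positive degree takes its values in `X`. -/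
theorem exists_polyVal_eq_coe {X : Type*} [Semigroup X] (l : List (WithOne X))
    (hl : 2 ≤ l.length) : ∃ f : X → X, ∀ x, polyVal l x = f x := by
  have key (a b : WithOne X) (x : X) : ∃ y : X, a * (x * b) = y := by
    induction a with
    | one =>
      induction b with
      | one => exact ⟨x, by simp⟩
      | coe b => exact ⟨x * b, by simp⟩
    | coe a =>
      induction b with
      | one => exact ⟨a * x, by simp⟩
      | coe b => exact ⟨a * (x * b), by simp⟩
  match l, hl with
  | a :: b :: l, _ =>
    simp only [polyVal_cons_cons]
    exact Classical.skolem.mp fun x => key a _ x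

/-- Every polybounded semigroup is polyfinite. -/
theorem statement8 {X : Type u} [Semigroup X] (h : Polybounded X) : Polyfinite X := by
  obtain ⟨C, hC, hA, hcov⟩ := h
  have : Finite C := hC
  choose a b ha hab using fun A : C => hA A A.2
  choose f hf using fun A : C => exists_polyVal_eq_coe (a A) (ha A)
  have hmem (x : X) : ∃ A : C, f A x = b A := by
    obtain ⟨A, hAC, hx⟩ := hcov (Set.mem_univ x)
    replace hx : polyVal (a ⟨A, hAC⟩) x = b ⟨A, hAC⟩ := (hab ⟨A, hAC⟩).subset hx
    exact ⟨⟨A, hAC⟩, WithOne.coe_injective ((hf _ x).symm.trans hx)⟩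
  choose c hc hcomp using fun p : C × C =>
    exists_polyVal_eq_comp (a p.2) (a p.1) (by intro h; simpa [h] using ha p.2)
      (ha p.1) (f p.1) (hf p.1)
  obtain ⟨n, hn⟩ := (Set.finite_range fun p => (c p).length).bddAbove
  refine ⟨n, Set.range (fun p : C × C => f p.2 (b p.1)) ∪ Set.range b,
    (Set.finite_range _).union (Set.finite_range _), fun x y => ?_⟩
  obtain ⟨A, hx⟩ := hmem x
  obtain ⟨B, hy⟩ := hmem (f A y)
  refine ⟨c (A, B), (ha B).trans (hc (A, B)), (hn ⟨(A, B), rfl⟩).trans n.le_succ,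
    ⟨f B (b A), Or.inl ⟨(A, B), rfl⟩, ?_⟩, ⟨b B, Or.inr ⟨B, rfl⟩, ?_⟩⟩
  · rw [hcomp, hf, hx]
  · rw [hcomp, hf, hy]

end ZeroClosedPaper
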